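/- Let G=(V,E) be a connected finite graph with m edges, α ∈ (0,1), and w_0 ∈ ℝ^m_+ a fixed initial weight vector. Then the entropy flow w_e'(t) = 𝔇_e^α(t), w_e(t) > 0, w_e(0) = w_{0,e} has a unique solution w(t) = (w_{e_1}(t),…,w_{e_m}(t)) defined for all t ∈ [0, +∞). -/

import Mathlib

open Finset Filter Topology

namespace EntropyFlowPaper

variable {V : Type*} [Fintype V] [DecidableEq V]

/-- Effective weight: the value of `w` on edges, `0` on non-edges. -/
noncomputable def ew (G : SimpleGraph V) [DecidableRel G.Adj] (w : Sym2 V → ℝ) (a b : V) : ℝ :=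
  if G.Adj a b then w s(a, b) else 0

/-- Auxiliary layers: `(layerAux G x j).1 = N_j(x)` and `(layerAux G x j).2 = ⋃_{k ≤ j} N_k(x)`:
the `(j+1)`-st layer consists of the vertices adjacent to `⋃_{k ≤ j} N_k(x)` that do not lie
in `⋃_{k ≤ j} N_k(x)`. -/
def layerAux (G : SimpleGraph V) [DecidableRel G.Adj] (x : V) : ℕ → Finset V × Finset V
  | 0 => ({x}, {x})
  | (j + 1) =>
      let p := layerAux G x j
      let next := Finset.univ.filter fun u => u ∉ p.2 ∧ ∃ a ∈ p.2, G.Adj u a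
      (next, p.2 ∪ next)

/-- The `j`-step neighbor set `N_j(x)`. -/
def layer (G : SimpleGraph V) [DecidableRel G.Adj] (x : V) (j : ℕ) : Finset V :=
  (layerAux G x j).1

/-- The outward-walk probability `P(x, z)`, for `z` in the `ℓ`-th layer `N_ℓ(x)`:
`P(x,z) = Σ_{chains x = z₀, z₁ ∈ N₁(x), …, z_{ℓ-1} ∈ N_{ℓ-1}(x), z_ℓ = z}
  Π_k w_{z_{k-1} z_k} / (Σ_{u ∈ N_k(x)} w_{z_{k-1} u})`, written recursively. -/
noncomputable def outP (G : SimpleGraph V) [DecidableRel G.Adj] (w : Sym2 V → ℝ) (x : V) :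
    ℕ → V → ℝ
  | 0, z => if z = x then 1 else 0
  | (ℓ + 1), z => ∑ y ∈ layer G x ℓ,
      outP G w x ℓ y * ew G w y z / ∑ u ∈ layer G x (ℓ + 1), ew G w y u

/-- The `α`-lazy outward random walk `R_x^α(z)`: it equals `α` at `z = x`; for `z ∈ N_j(x)`
(`j ≥ 1`) it equals `(1-α)^j * α * P(x,z)` if `z` is adjacent to `N_{j+1}(x)`, and
`(1-α)^j * P(x,z)` otherwise. -/
noncomputable def lazyWalk (G : SimpleGraph V) [DecidableRel G.Adj] (w : Sym2 V → ℝ) (α : ℝ)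
    (x z : V) : ℝ :=
  if z = x then α
  else ∑ j ∈ Finset.Icc 1 (Fintype.card V),
    (if z ∈ layer G x j then
      (if ∃ u ∈ layer G x (j + 1), G.Adj z u then (1 - α) ^ j * α * outP G w x j z
       else (1 - α) ^ j * outP G w x j z)
     else 0)

/-- Kullback–Leibler divergence `D_KL(P, Q) = Σ_z P z * log (P z / Q z)` on a finite set. -/
noncomputable def KL (P Q : V → ℝ) : ℝ := ∑ z, P z * Real.log (P z / Q z)

/-- The edge entropy `𝔇_e^α = D_KL(R_x^α, R_y^α) + D_KL(R_y^α, R_x^α)` for the edge `e = xy`. -/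
noncomputable def entropyD (G : SimpleGraph V) [DecidableRel G.Adj] (w : Sym2 V → ℝ) (α : ℝ)
    (x y : V) : ℝ :=
  KL (lazyWalk G w α x) (lazyWalk G w α y) + KL (lazyWalk G w α y) (lazyWalk G w α x)

/-- Euclidean distance `|w - w'|` between two weight vectors, over the edges of `G`. -/
noncomputable def wdist (G : SimpleGraph V) [DecidableRel G.Adj] (w w' : Sym2 V → ℝ) : ℝ :=
  Real.sqrt (∑ e ∈ G.edgeFinset, (w e - w' e) ^ 2)

/-- `w` is a solution of the entropy flow `w_e'(t) = 𝔇_e^α(t)`, `w_e(t) > 0`, `w_e(0) = w0_e`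
on the time set `S`. -/
def IsEntropyFlowSolutionOn (G : SimpleGraph V) [DecidableRel G.Adj] (α : ℝ)
    (w0 : Sym2 V → ℝ) (S : Set ℝ) (w : ℝ → Sym2 V → ℝ) : Prop :=
  (∀ e ∈ G.edgeFinset, w 0 e = w0 e) ∧
  (∀ t ∈ S, ∀ e ∈ G.edgeFinset, 0 < w t e) ∧
  (∀ t ∈ S, ∀ x y : V, G.Adj x y →
    HasDerivWithinAt (fun τ => w τ s(x, y)) (entropyD G (w t) α x y) S t)

end EntropyFlowPaper

open EntropyFlowPaper

section ODE

variable {ι : Type*} [Fintype ι]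

theorem lipschitzWith_clamp (a b : ι → ℝ) :
    LipschitzWith 1 fun w : ι → ℝ => (w ⊔ a) ⊓ b := by
  refine LipschitzWith.of_dist_le_mul fun x y => ?_
  rw [NNReal.coe_one, one_mul]
  refine (dist_pi_le_iff dist_nonneg).2 fun i => ?_
  refine le_trans ?_ (dist_le_pi_dist x y i)
  simp only [Real.dist_eq, Pi.inf_apply, Pi.sup_apply]
  exact (abs_inf_sub_inf_le_abs _ _ _).trans (abs_sup_sub_sup_le_abs _ _ _)

/-- A coordinate of an integral curve of a nonnegative vector field is nondecreasing. -/
theorem le_of_hasDerivWithinAt_nonneg {f f' : ℝ → ℝ} {s : Set ℝ} (hs : Convex ℝ s)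
    (h0 : (0 : ℝ) ∈ s) (hs0 : s ⊆ Set.Ici 0)
    (hf : ∀ t ∈ s, HasDerivWithinAt f (f' t) s t) (hf' : ∀ t ∈ s, 0 ≤ f' t)
    {t : ℝ} (ht : t ∈ s) : f 0 ≤ f t :=
  monotoneOn_of_hasDerivWithinAt_nonneg hs (fun t ht => (hf t ht).continuousWithinAt)
    (fun t ht => (hf t (interior_subset ht)).mono interior_subset)
    (fun t ht => hf' t (interior_subset ht)) h0 ht (hs0 ht)

/-- Existence on `[0, T]` for a vector field which is nonnegative and small enough on a box. -/
theorem exists_solution_Icc {F : (ι → ℝ) → ι → ℝ} {w0 : ι → ℝ} {T r : ℝ} (hT : 0 < T)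
    (hr : 0 ≤ r) {K : NNReal} (hK : LipschitzOnWith K F (Set.Icc w0 (w0 + fun _ => r)))
    (hnn : ∀ w ∈ Set.Icc w0 (w0 + fun _ => r), 0 ≤ F w)
    (hF : ∀ w ∈ Set.Icc w0 (w0 + fun _ => r), ‖F w‖ ≤ r / T) :
    ∃ w : ℝ → ι → ℝ, w 0 = w0 ∧ ∀ t ∈ Set.Icc 0 T, w0 ≤ w t ∧
      HasDerivWithinAt w (F (w t)) (Set.Icc 0 T) t := by
  set b : ι → ℝ := w0 + fun _ => r with hb
  have hw0b : w0 ≤ b := fun i => by simp [hb, hr]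
  set c : (ι → ℝ) → ι → ℝ := fun w => (w ⊔ w0) ⊓ b with hc
  have hcm : ∀ w, c w ∈ Set.Icc w0 b := fun w => ⟨le_inf le_sup_right hw0b, inf_le_right⟩
  have hrT : 0 ≤ r / T := div_nonneg hr hT.le
  have hpl : IsPicardLindelof (fun _ => F ∘ c) (⟨0, le_rfl, hT.le⟩ : Set.Icc (0 : ℝ) T) w0
      ⟨r, hr⟩ 0 ⟨r / T, hrT⟩ (K * 1) := by
    refine IsPicardLindelof.of_time_independent (fun w _ => hF _ (hcm w)) ?_ ?_
    · exact hK.comp ((lipschitzWith_clamp w0 b).lipschitzOnWith) fun w _ => hcm w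
    · simp only [sub_zero, sub_self, NNReal.coe_zero, max_eq_left hT.le]
      exact (div_mul_cancel₀ _ hT.ne').le
  obtain ⟨w, hwi, hw⟩ := hpl.exists_eq_forall_mem_Icc_hasDerivWithinAt₀
  have hwi : w 0 = w0 := hwi
  have hlow : ∀ t ∈ Set.Icc 0 T, w0 ≤ w t := fun t ht i => by
    rw [← hwi]
    exact le_of_hasDerivWithinAt_nonneg (f := fun τ => w τ i) (convex_Icc 0 T)
      ⟨le_rfl, hT.le⟩ (fun _ h => h.1) (fun t ht => hasDerivWithinAt_pi.1 (hw t ht) i)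
      (fun t _ => hnn _ (hcm (w t)) i) ht
  have hup : ∀ t ∈ Set.Icc 0 T, w t ≤ b := fun t ht i => by
    have h := (convex_Icc 0 T).norm_image_sub_le_of_norm_hasDerivWithin_le
      (C := r / T) hw (fun s _ => hF _ (hcm (w s))) ⟨le_rfl, hT.le⟩ ht
    have h1 : w t i - w0 i ≤ r := calc
      w t i - w0 i ≤ ‖(w t - w0) i‖ := le_abs_self _
      _ ≤ ‖w t - w0‖ := norm_le_pi_norm _ i
      _ ≤ r / T * ‖t - 0‖ := by rw [← hwi]; exact h
      _ ≤ r / T * T := by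
        gcongr
        rw [sub_zero, Real.norm_eq_abs, abs_of_nonneg ht.1]
        exact ht.2
      _ = r := div_mul_cancel₀ _ hT.ne'
    simp only [hb, Pi.add_apply]
    linarith
  refine ⟨w, hwi, fun t ht => ⟨hlow t ht, ?_⟩⟩
  have h := hw t ht
  have hcw : c (w t) = w t := by
    simp only [hc]
    rw [sup_eq_left.2 (hlow t ht), inf_eq_left.2 (hup t ht)]
  simpa only [Function.comp_apply, hcw] using h

/-- Two solutions above `w0` with the same initial value agree when the field is Lipschitz on every
box with lower corner `w0`. -/
theorem solution_unique_Icc {F : (ι → ℝ) → ι → ℝ} {w0 : ι → ℝ}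
    (hlip : ∀ b, ∃ K, LipschitzOnWith K F (Set.Icc w0 b)) {T : ℝ} {w w' : ℝ → ι → ℝ}
    (h0 : w 0 = w' 0)
    (hw : ∀ t ∈ Set.Icc 0 T, w0 ≤ w t ∧ HasDerivWithinAt w (F (w t)) (Set.Icc 0 T) t)
    (hw' : ∀ t ∈ Set.Icc 0 T, w0 ≤ w' t ∧ HasDerivWithinAt w' (F (w' t)) (Set.Icc 0 T) t) :
    Set.EqOn w w' (Set.Icc 0 T) := by
  have hc : ContinuousOn w (Set.Icc 0 T) := fun t ht => (hw t ht).2.continuousWithinAt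
  have hc' : ContinuousOn w' (Set.Icc 0 T) := fun t ht => (hw' t ht).2.continuousWithinAt
  have hbdd : ∀ {v : ℝ → ι → ℝ}, ContinuousOn v (Set.Icc 0 T) →
      ∃ b, ∀ t ∈ Set.Icc 0 T, v t ≤ b := fun {v} hv => by
    have h : ∀ i, ∃ b, ∀ t ∈ Set.Icc 0 T, v t i ≤ b := fun i => by
      obtain ⟨b, hb⟩ := isCompact_Icc.bddAbove_image (continuousOn_pi.1 hv i)
      exact ⟨b, fun t ht => hb ⟨t, ht, rfl⟩⟩
    choose b hb using h
    exact ⟨b, fun t ht i => hb i t ht⟩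
  obtain ⟨b, hb⟩ := hbdd hc
  obtain ⟨b', hb'⟩ := hbdd hc'
  obtain ⟨K, hK⟩ := hlip (b ⊔ b')
  have hder : ∀ {v : ℝ → ι → ℝ} {v' : ι → ℝ} {t : ℝ}, t ∈ Set.Ico 0 T →
      HasDerivWithinAt v v' (Set.Icc 0 T) t → HasDerivWithinAt v v' (Set.Ici t) t :=
    fun {v v' t} ht h => by
      refine (h.mono (Set.Icc_subset_Icc_left ht.1)).mono_of_mem_nhdsWithin ?_
      exact Icc_mem_nhdsGE ht.2
  exact ODE_solution_unique_of_mem_Icc_right (v := fun _ => F) (s := fun _ => Set.Icc w0 (b ⊔ b'))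
    (fun _ _ => hK) hc (fun t ht => hder ht (hw t (Set.Ico_subset_Icc_self ht)).2)
    (fun t ht => ⟨(hw t (Set.Ico_subset_Icc_self ht)).1,
      (hb t (Set.Ico_subset_Icc_self ht)).trans le_sup_left⟩)
    hc' (fun t ht => hder ht (hw' t (Set.Ico_subset_Icc_self ht)).2)
    (fun t ht => ⟨(hw' t (Set.Ico_subset_Icc_self ht)).1,
      (hb' t (Set.Ico_subset_Icc_self ht)).trans le_sup_right⟩) h0

/-- Solutions on all the intervals `[0, T]` glue to a solution on `[0, ∞)`. -/
theorem exists_solution_Ici {F : (ι → ℝ) → ι → ℝ} {w0 : ι → ℝ}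
    (hlip : ∀ b, ∃ K, LipschitzOnWith K F (Set.Icc w0 b))
    (hex : ∀ T : ℝ, 0 < T → ∃ w : ℝ → ι → ℝ, w 0 = w0 ∧ ∀ t ∈ Set.Icc 0 T, w0 ≤ w t ∧
      HasDerivWithinAt w (F (w t)) (Set.Icc 0 T) t) :
    ∃ w : ℝ → ι → ℝ, w 0 = w0 ∧ ∀ t ∈ Set.Ici (0 : ℝ), w0 ≤ w t ∧
      HasDerivWithinAt w (F (w t)) (Set.Ici 0) t := by
  choose! u hu0 hu using fun n : ℕ => hex (n + 1) n.cast_add_one_pos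
  have hagree : ∀ {m n : ℕ}, m ≤ n → Set.EqOn (u m) (u n) (Set.Icc 0 (m + 1)) := fun {m n} hmn => by
    have hsub : Set.Icc (0 : ℝ) (m + 1) ⊆ Set.Icc 0 (n + 1) :=
      Set.Icc_subset_Icc_right (by gcongr)
    exact solution_unique_Icc hlip ((hu0 m).trans (hu0 n).symm) (hu m)
      fun t ht => ⟨(hu n t (hsub ht)).1, (hu n t (hsub ht)).2.mono hsub⟩
  set w : ℝ → ι → ℝ := fun t => u ⌈t⌉₊ t with hwdef
  have hw : ∀ n : ℕ, ∀ t ∈ Set.Icc (0 : ℝ) n, w t = u n t := fun n t ht =>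
    hagree (Nat.ceil_le.2 ht.2) ⟨ht.1, (Nat.le_ceil t).trans (by linarith)⟩
  refine ⟨w, (hw 0 0 (by simp)).trans (hu0 0), fun t ht => ?_⟩
  obtain ⟨n, hn⟩ := exists_nat_gt t
  have htn : t ∈ Set.Icc (0 : ℝ) n := ⟨ht, hn.le⟩
  have hsub : Set.Icc (0 : ℝ) n ⊆ Set.Icc 0 (n + 1) := Set.Icc_subset_Icc_right (by linarith)
  rw [hw n t htn]
  refine ⟨(hu n t (hsub htn)).1, ?_⟩
  refine (((hu n t (hsub htn)).2.mono hsub).congr (hw n) (hw n t htn)).mono_of_mem_nhdsWithin ?_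
  rw [← Set.Ici_inter_Iic]
  exact Filter.inter_mem self_mem_nhdsWithin (mem_nhdsWithin_of_mem_nhds (Iic_mem_nhds hn))

end ODE

namespace EntropyFlowPaper

section Layers

variable {V : Type*} [Fintype V] [DecidableEq V] (G : SimpleGraph V) [DecidableRel G.Adj]

theorem mem_layer_zero {x z : V} : z ∈ layer G x 0 ↔ z = x := by
  simp [layer, layerAux]

theorem mem_layer_succ {x z : V} {j : ℕ} :
    z ∈ layer G x (j + 1) ↔ z ∉ (layerAux G x j).2 ∧ ∃ a ∈ (layerAux G x j).2, G.Adj z a := by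
  simp [layer, layerAux]

theorem mem_layerAux_snd_succ {x z : V} {j : ℕ} :
    z ∈ (layerAux G x (j + 1)).2 ↔ z ∈ (layerAux G x j).2 ∨ z ∈ layer G x (j + 1) := by
  simp [layer, layerAux]

theorem mem_layerAux_snd {x z : V} {j : ℕ} :
    z ∈ (layerAux G x j).2 ↔ ∃ i ≤ j, z ∈ layer G x i := by
  induction j with
  | zero => simp [layer, layerAux]
  | succ j ih =>
    rw [mem_layerAux_snd_succ, ih]
    constructor
    · rintro (⟨i, hi, h⟩ | h)
      · exact ⟨i, hi.trans j.le_succ, h⟩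
      · exact ⟨j + 1, le_rfl, h⟩
    · rintro ⟨i, hi, h⟩
      rcases Nat.le_succ_iff.1 hi with hi | rfl
      · exact Or.inl ⟨i, hi, h⟩
      · exact Or.inr h

theorem mem_layerAux_snd_succ_of_adj {x y z : V} {j : ℕ} (hy : y ∈ (layerAux G x j).2)
    (h : G.Adj y z) : z ∈ (layerAux G x (j + 1)).2 := by
  rw [mem_layerAux_snd_succ, mem_layer_succ]
  by_cases hz : z ∈ (layerAux G x j).2
  · exact Or.inl hz
  · exact Or.inr ⟨hz, y, hy, h.symm⟩

theorem exists_adj_of_mem_layer_succ {x z : V} {j : ℕ} (hz : z ∈ layer G x (j + 1)) :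
    ∃ y ∈ layer G x j, G.Adj y z := by
  obtain ⟨hz', a, ha, hza⟩ := (mem_layer_succ G).1 hz
  refine ⟨a, ?_, hza.symm⟩
  cases j with
  | zero => simpa [layer, layerAux] using ha
  | succ j =>
    refine ((mem_layerAux_snd_succ G).1 ha).resolve_left fun ha' => hz' ?_
    exact mem_layerAux_snd_succ_of_adj G ha' hza.symm

theorem mem_layerAux_snd_of_walk {x y z : V} (p : G.Walk y z) {j : ℕ}
    (hy : y ∈ (layerAux G x j).2) : z ∈ (layerAux G x (j + p.length)).2 := by
  induction p generalizing j with
  | nil => simpa using hy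
  | cons h p ih =>
    have := ih (mem_layerAux_snd_succ_of_adj G hy h)
    rwa [SimpleGraph.Walk.length_cons, add_comm p.length 1, ← add_assoc]

variable {G}

theorem exists_mem_layer (hG : G.Connected) {x z : V} (hzx : z ≠ x) :
    ∃ j ∈ Finset.Icc 1 (Fintype.card V), z ∈ layer G x j := by
  obtain ⟨p, hp⟩ := (hG x z).exists_isPath
  have hz := mem_layerAux_snd_of_walk (x := x) G p (j := 0) (by simp [layerAux])
  obtain ⟨j, hj, hzj⟩ := (mem_layerAux_snd G).1 hz
  have := hp.length_lt
  refine ⟨j, Finset.mem_Icc.2 ⟨Nat.one_le_iff_ne_zero.2 ?_, by omega⟩, hzj⟩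
  rintro rfl
  exact hzx ((mem_layer_zero G).1 hzj)

end Layers

section EdgeWeight

variable {V : Type*} {G : SimpleGraph V} [DecidableRel G.Adj] {w : Sym2 V → ℝ}

theorem ew_nonneg (hw : ∀ e, 0 < w e) (a b : V) : 0 ≤ ew G w a b := by
  unfold ew
  split_ifs
  exacts [(hw _).le, le_rfl]

theorem ew_of_adj {a b : V} (h : G.Adj a b) : ew G w a b = w s(a, b) := if_pos h

theorem contDiffAt_ew [Fintype V] (a b : V) : ContDiffAt ℝ 1 (fun w => ew G w a b) w := by
  unfold ew
  split_ifs
  · exact contDiffAt_apply ..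
  · exact contDiffAt_const

end EdgeWeight

section Estimates

variable {V : Type*} [Fintype V] [DecidableEq V] {G : SimpleGraph V} [DecidableRel G.Adj]
  {w : Sym2 V → ℝ}

theorem outP_nonneg (hw : ∀ e, 0 < w e) (x : V) (j : ℕ) (z : V) : 0 ≤ outP G w x j z := by
  induction j generalizing z with
  | zero => unfold outP; split_ifs <;> norm_num
  | succ j ih =>
    unfold outP
    exact Finset.sum_nonneg fun y _ => div_nonneg (mul_nonneg (ih y) (ew_nonneg hw y z))
      (Finset.sum_nonneg fun u _ => ew_nonneg hw y u)

theorem outP_le (hw : ∀ e, 0 < w e) (x : V) (j : ℕ) {z : V} (hz : z ∈ layer G x j) :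
    outP G w x j z ≤ (Fintype.card V : ℝ) ^ j := by
  induction j generalizing z with
  | zero => unfold outP; split_ifs <;> norm_num
  | succ j ih =>
    have h : ∀ y ∈ layer G x j, outP G w x j y * ew G w y z / ∑ u ∈ layer G x (j + 1), ew G w y u
        ≤ (Fintype.card V : ℝ) ^ j := fun y hy => by
      rw [mul_div_assoc]
      refine (mul_le_of_le_one_right (outP_nonneg hw x j y) ?_).trans (ih hy)
      exact div_le_one_of_le₀
        (Finset.single_le_sum (f := fun u => ew G w y u) (fun u _ => ew_nonneg hw y u) hz)
        (Finset.sum_nonneg fun u _ => ew_nonneg hw y u)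
    unfold outP
    refine (Finset.sum_le_card_nsmul _ _ _ h).trans ?_
    rw [nsmul_eq_mul, pow_succ']
    gcongr
    exact Finset.card_le_univ _

theorem le_outP {m M : ℝ} (hm : 0 < m) (hmw : ∀ e, m ≤ w e) (hwM : ∀ e, w e ≤ M) (x : V) (j : ℕ)
    {z : V} (hz : z ∈ layer G x j) : (m / (Fintype.card V * M)) ^ j ≤ outP G w x j z := by
  have hw : ∀ e, 0 < w e := fun e => hm.trans_le (hmw e)
  have hM : 0 < M := (hw s(x, x)).trans_le (hwM _)
  have hn : 0 < (Fintype.card V : ℝ) := Nat.cast_pos.2 (Fintype.card_pos_iff.2 ⟨x⟩)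
  induction j generalizing z with
  | zero => simp [outP, (mem_layer_zero G).1 hz]
  | succ j ih =>
    obtain ⟨y, hy, hyz⟩ := exists_adj_of_mem_layer_succ G hz
    have hS : ∑ u ∈ layer G x (j + 1), ew G w y u ≤ Fintype.card V * M := by
      refine (Finset.sum_le_card_nsmul _ _ M fun u _ => ?_).trans ?_
      · unfold ew
        split_ifs
        exacts [hwM _, hM.le]
      · rw [nsmul_eq_mul]
        gcongr
        exact Finset.card_le_univ _
    have hS0 : 0 < ∑ u ∈ layer G x (j + 1), ew G w y u := by
      refine Finset.sum_pos' (fun u _ => ew_nonneg hw y u) ⟨z, hz, ?_⟩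
      rw [ew_of_adj hyz]
      exact hw _
    have h : (m / (Fintype.card V * M)) ^ (j + 1) ≤
        outP G w x j y * ew G w y z / ∑ u ∈ layer G x (j + 1), ew G w y u := by
      rw [mul_div_assoc, pow_succ, ew_of_adj hyz]
      have := ih hy
      have := hmw s(y, z)
      have := hw s(y, z)
      have := outP_nonneg (G := G) hw x j y
      gcongr
    unfold outP
    exact h.trans <| Finset.single_le_sum
      (f := fun y => outP G w x j y * ew G w y z / ∑ u ∈ layer G x (j + 1), ew G w y u)
      (fun y _ => div_nonneg (mul_nonneg (outP_nonneg hw x j y) (ew_nonneg hw y z))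
      (Finset.sum_nonneg fun u _ => ew_nonneg hw y u)) hy

variable {α : ℝ}

theorem lazyWalk_le (hα : α ∈ Set.Ioo (0 : ℝ) 1) (hw : ∀ e, 0 < w e) (x z : V) :
    lazyWalk G w α x z ≤ 1 + ∑ j ∈ Finset.Icc 1 (Fintype.card V), (Fintype.card V : ℝ) ^ j := by
  obtain ⟨h0, h1⟩ := hα
  have hpos : 0 ≤ ∑ j ∈ Finset.Icc 1 (Fintype.card V), (Fintype.card V : ℝ) ^ j := by positivity
  unfold lazyWalk
  split_ifs with hzx
  · linarith
  · refine le_add_of_nonneg_of_le zero_le_one (Finset.sum_le_sum fun j _ => ?_)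
    have hq0 : 0 ≤ (1 - α) ^ j := pow_nonneg (by linarith) j
    have hq : (1 - α) ^ j ≤ 1 := pow_le_one₀ (by linarith) (by linarith)
    split_ifs with hz
    · exact (mul_le_of_le_one_left (outP_nonneg hw x j z)
        (mul_le_one₀ hq h0.le h1.le)).trans (outP_le hw x j hz)
    · exact (mul_le_of_le_one_left (outP_nonneg hw x j z) hq).trans (outP_le hw x j hz)
    · positivity

theorem le_lazyWalk (hG : G.Connected) (hα : α ∈ Set.Ioo (0 : ℝ) 1) {m M : ℝ} (hm : 0 < m)
    (hmw : ∀ e, m ≤ w e) (hwM : ∀ e, w e ≤ M) (x z : V) :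
    α * ((1 - α) * (m / (Fintype.card V * M))) ^ Fintype.card V ≤ lazyWalk G w α x z := by
  obtain ⟨h0, h1⟩ := hα
  have hw : ∀ e, 0 < w e := fun e => hm.trans_le (hmw e)
  have hM : 0 < M := (hw s(x, x)).trans_le (hwM _)
  have hn : 1 ≤ (Fintype.card V : ℝ) := Nat.one_le_cast.2 (Fintype.card_pos_iff.2 ⟨x⟩)
  have hmM : m ≤ M := (hmw s(x, x)).trans (hwM _)
  set ρ : ℝ := m / (Fintype.card V * M) with hρ
  have hρ0 : 0 ≤ ρ := by positivity
  have hρ1 : ρ ≤ 1 := div_le_one_of_le₀ (by nlinarith) (by positivity)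
  have hq0 : 0 ≤ (1 - α) * ρ := mul_nonneg (by linarith) hρ0
  have hq1 : (1 - α) * ρ ≤ 1 := mul_le_one₀ (by linarith) hρ0 hρ1
  unfold lazyWalk
  split_ifs with hzx
  · exact mul_le_of_le_one_right h0.le (pow_le_one₀ hq0 hq1)
  · obtain ⟨j, hj, hz⟩ := exists_mem_layer hG hzx
    have hpow : ∀ i, 0 ≤ (1 - α) ^ i := fun i => pow_nonneg (by linarith) i
    have hP := le_outP hm hmw hwM x j hz
    have hle : α * ((1 - α) * ρ) ^ Fintype.card V ≤ (1 - α) ^ j * α * outP G w x j z := calc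
      α * ((1 - α) * ρ) ^ Fintype.card V ≤ α * ((1 - α) * ρ) ^ j :=
        mul_le_mul_of_nonneg_left (pow_le_pow_of_le_one hq0 hq1 (Finset.mem_Icc.1 hj).2) h0.le
      _ = (1 - α) ^ j * α * ρ ^ j := by rw [mul_pow]; ring
      _ ≤ _ := mul_le_mul_of_nonneg_left hP (mul_nonneg (hpow j) h0.le)
    refine le_trans ?_ (Finset.single_le_sum (fun i _ => ?_) hj)
    · rw [if_pos hz]
      split_ifs
      · exact hle
      · refine hle.trans (mul_le_mul_of_nonneg_right ?_ (outP_nonneg hw x j z))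
        exact mul_le_of_le_one_right (hpow j) h1.le
    · have := outP_nonneg (G := G) hw x i z
      have := hpow i
      split_ifs <;> positivity

theorem lazyWalk_pos (hG : G.Connected) (hα : α ∈ Set.Ioo (0 : ℝ) 1) (hw : ∀ e, 0 < w e)
    (x z : V) : 0 < lazyWalk G w α x z := by
  have : Nonempty (Sym2 V) := ⟨s(x, x)⟩
  obtain ⟨e, he⟩ := Finite.exists_min w
  obtain ⟨e', he'⟩ := Finite.exists_max w
  have hn : 0 < (Fintype.card V : ℝ) := Nat.cast_pos.2 (Fintype.card_pos_iff.2 ⟨x⟩)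
  refine lt_of_lt_of_le ?_ (le_lazyWalk hG hα (hw e) he he' x z)
  have := hw e
  have := hw e'
  have := hα.1
  have : 0 < 1 - α := by linarith [hα.2]
  positivity

theorem entropyD_eq_sum (hG : G.Connected) (hα : α ∈ Set.Ioo (0 : ℝ) 1) (hw : ∀ e, 0 < w e)
    (x y : V) :
    entropyD G w α x y = ∑ z, (lazyWalk G w α x z - lazyWalk G w α y z) *
      (Real.log (lazyWalk G w α x z) - Real.log (lazyWalk G w α y z)) := by
  unfold entropyD KL
  rw [← Finset.sum_add_distrib]
  refine Finset.sum_congr rfl fun z _ => ?_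
  have hx := (lazyWalk_pos hG hα hw x z).ne'
  have hy := (lazyWalk_pos hG hα hw y z).ne'
  rw [Real.log_div hx hy, Real.log_div hy hx]
  ring

theorem entropyD_nonneg (hG : G.Connected) (hα : α ∈ Set.Ioo (0 : ℝ) 1) (hw : ∀ e, 0 < w e)
    (x y : V) : 0 ≤ entropyD G w α x y := by
  rw [entropyD_eq_sum hG hα hw]
  refine Finset.sum_nonneg fun z _ => ?_
  have hx := lazyWalk_pos hG hα hw x z
  have hy := lazyWalk_pos hG hα hw y z
  rcases le_total (lazyWalk G w α x z) (lazyWalk G w α y z) with h | h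
  · exact mul_nonneg_of_nonpos_of_nonpos (sub_nonpos.2 h) (sub_nonpos.2 (Real.log_le_log hx h))
  · exact mul_nonneg (sub_nonneg.2 h) (sub_nonneg.2 (Real.log_le_log hy h))

theorem exists_abs_log_lazyWalk_le (hG : G.Connected) (hα : α ∈ Set.Ioo (0 : ℝ) 1) {m : ℝ}
    (hm : 0 < m) : ∃ A : ℝ, ∀ M : ℝ, 1 ≤ M → ∀ w : Sym2 V → ℝ, (∀ e, m ≤ w e) → (∀ e, w e ≤ M) →
      ∀ x z, |Real.log (lazyWalk G w α x z)| ≤ A + Fintype.card V * Real.log M := by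
  set n : ℕ := Fintype.card V with hn
  set C : ℝ := 1 + ∑ j ∈ Finset.Icc 1 n, (n : ℝ) ^ j with hC
  set c : ℝ := α * ((1 - α) * (m / n)) ^ n with hc
  have hC1 : 1 ≤ C := le_add_of_nonneg_right (by positivity)
  refine ⟨|Real.log c| + Real.log C, fun M hM w hmw hwM x z => ?_⟩
  have hw : ∀ e, 0 < w e := fun e => hm.trans_le (hmw e)
  have hM0 : 0 < M := zero_lt_one.trans_le hM
  have hn0 : 0 < (n : ℝ) := Nat.cast_pos.2 (Fintype.card_pos_iff.2 ⟨x⟩)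
  have hc0 : 0 < c := by
    have := hα.1
    have : 0 < 1 - α := by linarith [hα.2]
    positivity
  have hR := lazyWalk_pos hG hα hw x z
  have hlow : c / M ^ n ≤ lazyWalk G w α x z := by
    refine Eq.trans_le ?_ (le_lazyWalk hG hα hm hmw hwM x z)
    rw [← hn, hc, mul_div_assoc, ← div_pow]
    congr 2
    field_simp
  have h1 := Real.log_le_log (by positivity) hlow
  rw [Real.log_div hc0.ne' (by positivity), Real.log_pow] at h1
  have h2 := Real.log_le_log hR (lazyWalk_le hα hw x z)
  rw [← hn, ← hC] at h2
  have h3 := Real.log_nonneg hC1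
  have h4 : 0 ≤ n * Real.log M := mul_nonneg hn0.le (Real.log_nonneg hM)
  have h5 := neg_abs_le (Real.log c)
  have h6 := abs_nonneg (Real.log c)
  exact abs_le.2 ⟨by linarith, by linarith⟩

/-- The edge entropy grows at most logarithmically in the largest weight. -/
theorem exists_entropyD_le (hG : G.Connected) (hα : α ∈ Set.Ioo (0 : ℝ) 1) {m : ℝ} (hm : 0 < m) :
    ∃ A B : ℝ, ∀ M : ℝ, 1 ≤ M → ∀ w : Sym2 V → ℝ, (∀ e, m ≤ w e) → (∀ e, w e ≤ M) →
      ∀ x y, entropyD G w α x y ≤ A + B * Real.log M := by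
  obtain ⟨A, hA⟩ := exists_abs_log_lazyWalk_le hG hα hm
  set n : ℕ := Fintype.card V with hn
  set C : ℝ := 1 + ∑ j ∈ Finset.Icc 1 n, (n : ℝ) ^ j with hC
  refine ⟨n * (C * (2 * A)), n * (C * (2 * n)), fun M hM w hmw hwM x y => ?_⟩
  have hw : ∀ e, 0 < w e := fun e => hm.trans_le (hmw e)
  rw [entropyD_eq_sum hG hα hw]
  have hterm : ∀ z ∈ (Finset.univ : Finset V),
      (lazyWalk G w α x z - lazyWalk G w α y z) *
      (Real.log (lazyWalk G w α x z) - Real.log (lazyWalk G w α y z)) ≤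
      C * (2 * (A + n * Real.log M)) := fun z _ => by
    have hx := lazyWalk_pos hG hα hw x z
    have hy := lazyWalk_pos hG hα hw y z
    have hx' := lazyWalk_le (G := G) hα hw x z
    have hy' := lazyWalk_le (G := G) hα hw y z
    rw [← hn, ← hC] at hx' hy'
    refine (le_abs_self _).trans ?_
    rw [abs_mul]
    refine mul_le_mul (abs_le.2 ⟨by linarith, by linarith⟩) ?_ (abs_nonneg _) (hx.le.trans hx')
    refine (abs_sub _ _).trans ?_
    linarith [hA M hM w hmw hwM x z, hA M hM w hmw hwM y z]
  refine (Finset.sum_le_card_nsmul _ _ _ hterm).trans_eq ?_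
  rw [nsmul_eq_mul, Finset.card_univ, ← hn]
  ring

theorem contDiffAt_outP (hw : ∀ e, 0 < w e) (x : V) (j : ℕ) (z : V) :
    ContDiffAt ℝ 1 (fun w => outP G w x j z) w := by
  induction j generalizing z with
  | zero => exact contDiffAt_const
  | succ j ih =>
    unfold outP
    refine ContDiffAt.sum fun y _ => ?_
    by_cases hy : ∃ u ∈ layer G x (j + 1), G.Adj y u
    · obtain ⟨u, hu, hyu⟩ := hy
      refine ((ih y).mul (contDiffAt_ew y z)).div
        (ContDiffAt.sum fun u _ => contDiffAt_ew y u) ?_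
      refine (Finset.sum_pos' (fun u _ => ew_nonneg hw y u) ⟨u, hu, ?_⟩).ne'
      rw [ew_of_adj hyu]
      exact hw _
    · have h : ∀ v : Sym2 V → ℝ, ∑ u ∈ layer G x (j + 1), ew G v y u = 0 := fun v =>
        Finset.sum_eq_zero fun u hu => if_neg fun hyu => hy ⟨u, hu, hyu⟩
      simp only [h, div_zero]
      exact contDiffAt_const

theorem contDiffAt_lazyWalk (hw : ∀ e, 0 < w e) (x z : V) :
    ContDiffAt ℝ 1 (fun w => lazyWalk G w α x z) w := by
  unfold lazyWalk
  split_ifs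
  · exact contDiffAt_const
  · refine ContDiffAt.sum fun j _ => ?_
    have := contDiffAt_outP (G := G) hw x j z
    split_ifs
    · exact contDiffAt_const.mul this
    · exact contDiffAt_const.mul this
    · exact contDiffAt_const

theorem contDiffAt_entropyD (hG : G.Connected) (hα : α ∈ Set.Ioo (0 : ℝ) 1) (hw : ∀ e, 0 < w e)
    (x y : V) : ContDiffAt ℝ 1 (fun w => entropyD G w α x y) w := by
  have hKL : ∀ x y, ContDiffAt ℝ 1 (fun w => KL (lazyWalk G w α x) (lazyWalk G w α y)) w :=
    fun x y => ContDiffAt.sum fun z _ => by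
      have hx := lazyWalk_pos hG hα hw x z
      have hy := lazyWalk_pos hG hα hw y z
      exact (contDiffAt_lazyWalk hw x z).mul
        (((contDiffAt_lazyWalk hw x z).div (contDiffAt_lazyWalk hw y z) hy.ne').log
          (div_pos hx hy).ne')
  exact (hKL x y).add (hKL y x)

end Estimates

section Field

variable {V : Type*} [Fintype V] [DecidableEq V] (G : SimpleGraph V) [DecidableRel G.Adj] (α : ℝ)

/-- The entropy flow vector field on all of `Sym2 V → ℝ`, vanishing off the edges of `G`. -/
noncomputable def entropyField (w : Sym2 V → ℝ) (e : Sym2 V) : ℝ :=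
  if e ∈ G.edgeFinset then
    Sym2.lift ⟨fun x y => entropyD G w α x y, fun _ _ => add_comm _ _⟩ e
  else 0

variable {G α}

theorem entropyField_of_adj {x y : V} (h : G.Adj x y) (w : Sym2 V → ℝ) :
    entropyField G α w s(x, y) = entropyD G w α x y := by
  simp [entropyField, h]

theorem entropyField_nonneg (hG : G.Connected) (hα : α ∈ Set.Ioo (0 : ℝ) 1) {w : Sym2 V → ℝ}
    (hw : ∀ e, 0 < w e) : 0 ≤ entropyField G α w := fun e => by
  induction e with
  | _ x y =>
    unfold entropyField
    split_ifs
    · exact entropyD_nonneg hG hα hw x y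
    · exact le_rfl

theorem contDiffAt_entropyField (hG : G.Connected) (hα : α ∈ Set.Ioo (0 : ℝ) 1) {w : Sym2 V → ℝ}
    (hw : ∀ e, 0 < w e) : ContDiffAt ℝ 1 (entropyField G α) w := by
  refine contDiffAt_pi.2 fun e => ?_
  induction e with
  | _ x y =>
    unfold entropyField
    split_ifs
    · exact contDiffAt_entropyD hG hα hw x y
    · exact contDiffAt_const

theorem exists_lipschitzOnWith_entropyField (hG : G.Connected) (hα : α ∈ Set.Ioo (0 : ℝ) 1)
    {w0 : Sym2 V → ℝ} (hw0 : ∀ e, 0 < w0 e) (b : Sym2 V → ℝ) :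
    ∃ K, LipschitzOnWith K (entropyField G α) (Set.Icc w0 b) :=
  (ContDiffOn.locallyLipschitzOn (convex_Icc w0 b) fun _ hw =>
    (contDiffAt_entropyField hG hα fun e =>
      (hw0 e).trans_le (hw.1 e)).contDiffWithinAt).exists_lipschitzOnWith_of_compact isCompact_Icc

/-- On a large enough box the field is too small for a solution to leave the box before time `T`. -/
theorem exists_norm_entropyField_le (hG : G.Connected) (hα : α ∈ Set.Ioo (0 : ℝ) 1)
    {w0 : Sym2 V → ℝ} (hw0 : ∀ e, 0 < w0 e) {T : ℝ} (hT : 0 < T) :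
    ∃ r : ℝ, 0 ≤ r ∧ ∀ w ∈ Set.Icc w0 (w0 + fun _ => r), ‖entropyField G α w‖ ≤ r / T := by
  have : Nonempty (Sym2 V) := hG.nonempty.map fun x => s(x, x)
  obtain ⟨e₀, he₀⟩ := Finite.exists_min w0
  obtain ⟨e₁, he₁⟩ := Finite.exists_max w0
  obtain ⟨A, B, hAB⟩ := exists_entropyD_le hG hα (hw0 e₀)
  have ho : (fun M : ℝ => A + B * Real.log M) =o[atTop] (id : ℝ → ℝ) :=
    (Asymptotics.isLittleO_const_id_atTop A).add (Real.isLittleO_log_id_atTop.const_mul_left B)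
  have hsmall := ho.def (c := 1 / (2 * T)) (by positivity)
  obtain ⟨M, hM, hM1, hM2⟩ :=
    (hsmall.and ((eventually_ge_atTop 1).and (eventually_ge_atTop (2 * w0 e₁)))).exists
  have hM0 : 0 < M := zero_lt_one.trans_le hM1
  have hr0 : 0 ≤ M - w0 e₁ := by linarith
  refine ⟨M - w0 e₁, hr0, fun w hw => ?_⟩
  have hwpos : ∀ e, 0 < w e := fun e => (hw0 e).trans_le (hw.1 e)
  have hAM : A + B * Real.log M ≤ (M - w0 e₁) / T := calc
    A + B * Real.log M ≤ 1 / (2 * T) * ‖id M‖ := (le_abs_self _).trans hM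
    _ = M / 2 / T := by rw [id, Real.norm_of_nonneg hM0.le]; field_simp
    _ ≤ (M - w0 e₁) / T := by gcongr; linarith
  refine (pi_norm_le_iff_of_nonneg (by positivity)).2 fun e => ?_
  rw [Real.norm_of_nonneg (entropyField_nonneg hG hα hwpos e)]
  induction e with
  | _ x y =>
    unfold entropyField
    split_ifs
    · refine (hAB M hM1 w (fun e => (he₀ e).trans (hw.1 e)) (fun e => ?_) x y).trans hAM
      have := hw.2 e
      simp only [Pi.add_apply] at this
      linarith [he₁ e]
    · positivity

theorem outP_congr {w w' : Sym2 V → ℝ} (h : ∀ a b, ew G w a b = ew G w' a b) (x : V) (j : ℕ)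
    (z : V) : outP G w x j z = outP G w' x j z := by
  induction j generalizing z with
  | zero => rfl
  | succ j ih => simp only [outP, ih, h]

/-- The edge entropy depends only on the weights of the edges. -/
theorem entropyD_congr {w w' : Sym2 V → ℝ} (h : ∀ e ∈ G.edgeFinset, w e = w' e) (x y : V) :
    entropyD G w α x y = entropyD G w' α x y := by
  have hew : ∀ a b, ew G w a b = ew G w' a b := fun a b => by
    unfold ew
    split_ifs with hab
    · exact h _ (by simpa using hab)
    · rfl
  have hR : ∀ a, lazyWalk G w α a = lazyWalk G w' α a := fun a => by
    have hP : outP G w a = outP G w' a := funext₂ (outP_congr hew a)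
    funext z
    unfold lazyWalk
    rw [hP]
  simp only [entropyD, hR]

/-- Extending a solution of the entropy flow by `1` off the edges gives an integral curve of
`entropyField` which stays above its initial value. -/
theorem IsEntropyFlowSolutionOn.extend (hG : G.Connected) (hα : α ∈ Set.Ioo (0 : ℝ) 1)
    {w0 : Sym2 V → ℝ} {w : ℝ → Sym2 V → ℝ} (h : IsEntropyFlowSolutionOn G α w0 (Set.Ici 0) w) :
    let v : ℝ → Sym2 V → ℝ := fun t e => if e ∈ G.edgeFinset then w t e else 1
    ∀ t ∈ Set.Ici (0 : ℝ), v 0 ≤ v t ∧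
      HasDerivWithinAt v (entropyField G α (v t)) (Set.Ici 0) t := by
  intro v
  obtain ⟨-, hpos, hder⟩ := h
  have hvpos : ∀ t ∈ Set.Ici (0 : ℝ), ∀ e, 0 < v t e := fun t ht e => by
    simp only [v]
    split_ifs with he
    exacts [hpos t ht e he, one_pos]
  have hv : ∀ t ∈ Set.Ici (0 : ℝ),
      HasDerivWithinAt v (entropyField G α (v t)) (Set.Ici 0) t := fun t ht => by
    refine hasDerivWithinAt_pi.2 fun e => ?_
    by_cases he : e ∈ G.edgeFinset
    · simp only [v, if_pos he]
      induction e with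
      | _ x y =>
        have hxy : G.Adj x y := by simpa using he
        rw [entropyField_of_adj hxy, entropyD_congr (w' := w t) fun e he => if_pos he]
        exact hder t ht x y hxy
    · simp only [v, entropyField, if_neg he]
      exact hasDerivWithinAt_const ..
  exact fun t ht => ⟨fun e => le_of_hasDerivWithinAt_nonneg (f := fun τ => v τ e) (convex_Ici 0)
    Set.self_mem_Ici subset_rfl (fun t ht => hasDerivWithinAt_pi.1 (hv t ht) e)
    (fun t ht => entropyField_nonneg hG hα (hvpos t ht) e) ht, hv t ht⟩

end Field

end EntropyFlowPaper

/-- global existence and uniqueness: the entropy flow with positive initial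
weight `w0` has a unique solution defined for all `t ∈ [0, +∞)`. -/
theorem entropyFlow_global_existence_uniqueness {V : Type*} [Fintype V] [DecidableEq V]
    (G : SimpleGraph V) [DecidableRel G.Adj] (hG : G.Connected)
    (α : ℝ) (hα : α ∈ Set.Ioo (0 : ℝ) 1)
    (w0 : Sym2 V → ℝ) (hw0 : ∀ e ∈ G.edgeFinset, 0 < w0 e) :
    (∃ w : ℝ → Sym2 V → ℝ, IsEntropyFlowSolutionOn G α w0 (Set.Ici 0) w) ∧
    (∀ w w' : ℝ → Sym2 V → ℝ,
      IsEntropyFlowSolutionOn G α w0 (Set.Ici 0) w →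
      IsEntropyFlowSolutionOn G α w0 (Set.Ici 0) w' →
      ∀ t ∈ Set.Ici (0 : ℝ), ∀ e ∈ G.edgeFinset, w t e = w' t e) := by
  classical
  set v0 : Sym2 V → ℝ := fun e => if e ∈ G.edgeFinset then w0 e else 1 with hv0
  have hv0pos : ∀ e, 0 < v0 e := fun e => by
    simp only [hv0]
    split_ifs with he
    exacts [hw0 e he, one_pos]
  have hlip := exists_lipschitzOnWith_entropyField hG hα hv0pos
  refine ⟨?_, fun w w' hw hw' t ht e he => ?_⟩
  · obtain ⟨w, hwi, hw⟩ := exists_solution_Ici hlip fun T hT => by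
      obtain ⟨r, hr, hF⟩ := exists_norm_entropyField_le hG hα hv0pos hT
      obtain ⟨K, hK⟩ := hlip (v0 + fun _ => r)
      exact exists_solution_Icc hT hr hK
        (fun _ hw => entropyField_nonneg hG hα fun e => (hv0pos e).trans_le (hw.1 e)) hF
    refine ⟨w, fun e he => ?_, fun t ht e _ => (hv0pos e).trans_le ((hw t ht).1 e),
      fun t ht x y hxy => ?_⟩
    · rw [hwi]
      exact if_pos he
    · rw [← entropyField_of_adj hxy]
      exact hasDerivWithinAt_pi.1 (hw t ht).2 s(x, y)
  · have hinit : ∀ {u : ℝ → Sym2 V → ℝ}, IsEntropyFlowSolutionOn G α w0 (Set.Ici 0) u →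
        (fun e => if e ∈ G.edgeFinset then u 0 e else 1) = v0 := fun {u} hu =>
      funext fun e => ite_congr rfl (fun he => hu.1 e he) fun _ => rfl
    have hsol : ∀ {u : ℝ → Sym2 V → ℝ}, IsEntropyFlowSolutionOn G α w0 (Set.Ici 0) u →
        let v : ℝ → Sym2 V → ℝ := fun t e => if e ∈ G.edgeFinset then u t e else 1
        ∀ s ∈ Set.Icc 0 t, v0 ≤ v s ∧
          HasDerivWithinAt v (entropyField G α (v s)) (Set.Icc 0 t) s := fun {u} hu => by
      intro v s hs
      obtain ⟨h1, h2⟩ := hu.extend hG hα s hs.1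
      exact ⟨(hinit hu).symm.le.trans h1, h2.mono Set.Icc_subset_Ici_self⟩
    have h := congrFun (solution_unique_Icc hlip ((hinit hw).trans (hinit hw').symm)
      (hsol hw) (hsol hw') ⟨ht, le_rfl⟩) e
    simpa only [if_pos he] using h
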